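/- (Reconstruction of HW-reduced density matrices with general phase convention.) Assume gcd(N, M) = 1, let ρ : Matrix S S ℂ, and let θ : ZMod M → ZMod M → ℝ be an arbitrary phase assignment. Define the phased multiphoton operators Ω_{k,l} = exp(i·N·θ(k,l)) • Λ_{k,l} and the phased single-photon matrices M1_{k,l} = exp(i·θ(k,l)) • L_{k,l}. Then ρ_HW = (1/M) · Σ_{k,l ∈ ZMod M} (trace(ρ * Ω_{k,l})) • (exp(i·(N·θ(k,l) − θ(k, N·l))) • M1_{k, N·l})ᴴ. -/

import Mathlib

open Matrix Complex BigOperators Finset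

noncomputable section

set_option linter.unusedVariables false

/-- `ω = exp(2πi/M)`. -/
def hwOmega (M : ℕ) : ℂ := Complex.exp (2 * Real.pi * Complex.I / M)

/-- Single-photon Heisenberg–Weyl matrix `L_{k,l} = X^k Z^l`,
with entries `L_{k,l}[m,m'] = ω^{l·m'}` if `m = m' + k` and `0` otherwise. -/
def HW (M : ℕ) [NeZero M] (k l : ZMod M) : Matrix (ZMod M) (ZMod M) ℂ :=
  Matrix.of fun m m' => if m = m' + k then hwOmega M ^ (l * m').val else 0

/-- Fock vectors: mode-occupation functions `ZMod M → ℕ` with total photon number `N`. -/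
abbrev Fock (M N : ℕ) [NeZero M] := {n : ZMod M → ℕ // ∑ m, n m = N}

instance (M N : ℕ) [NeZero M] : Fintype (Fock M N) :=
  Fintype.ofInjective
    (fun n (m : ZMod M) => (⟨n.1 m, Nat.lt_succ_of_le (le_of_le_of_eq
      (Finset.single_le_sum (fun i _ => Nat.zero_le _) (Finset.mem_univ m)) n.2)⟩ : Fin (N+1)))
    (fun a b h => Subtype.ext (funext fun m => congrArg Fin.val (congrFun h m)))

/-- The mode shift `σ`, `(σ n)(m) = n(m - 1)`. -/
def modeShift (M N : ℕ) [NeZero M] (n : Fock M N) : Fock M N :=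
  ⟨fun m => n.1 (m - 1), by
    exact (Fintype.sum_equiv (Equiv.subRight (1 : ZMod M)) _ _ (fun m => rfl)).trans n.2⟩

/-- The total mode index `μ(n) = ∑ m, m·n(m) ∈ ZMod M`. -/
def tmi (M N : ℕ) [NeZero M] (n : Fock M N) : ZMod M := ∑ m : ZMod M, m * (n.1 m : ZMod M)

/-- Multiphoton Heisenberg–Weyl matrix `Λ_{k,l}`, with entries `ω^{l·μ(n)}` at `(σ^k n, n)`
and `0` elsewhere. -/
def HWm (M N : ℕ) [NeZero M] (k l : ZMod M) : Matrix (Fock M N) (Fock M N) ℂ :=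
  Matrix.of fun v n =>
    if v = (modeShift M N)^[k.val] n then hwOmega M ^ (l * tmi M N n).val else 0

/-- The HW-reduced density matrix,
`ρ_HW[m,m'] = ∑_{ñ ∈ S, μ(ñ) = 0} ρ[σ^m ñ, σ^{m'} ñ]`. -/
def rhoHW (M N : ℕ) [NeZero M] (ρ : Matrix (Fock M N) (Fock M N) ℂ) :
    Matrix (ZMod M) (ZMod M) ℂ :=
  Matrix.of fun m m' => ∑ t : Fock M N,
    if tmi M N t = 0 then ρ ((modeShift M N)^[m.val] t) ((modeShift M N)^[m'.val] t) else 0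

lemma hwOmega_pow_val (M : ℕ) [NeZero M] (a : ZMod M) :
    hwOmega M ^ a.val = ZMod.stdAddChar a := by
  rw [ZMod.stdAddChar_apply, ZMod.toCircle_apply, hwOmega, ← Complex.exp_nat_mul]
  congr 1
  ring

lemma sum_hwOmega_pow_mul_conj (M : ℕ) [NeZero M] (a b : ZMod M) :
    ∑ l : ZMod M, hwOmega M ^ (l * a).val * star (hwOmega M ^ (l * b).val) =
      if a = b then (M : ℂ) else 0 := by
  have h (l : ZMod M) : hwOmega M ^ (l * a).val * star (hwOmega M ^ (l * b).val) =
      ZMod.stdAddChar (l * (a - b)) := by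
    rw [hwOmega_pow_val, hwOmega_pow_val, mul_sub, sub_eq_add_neg, AddChar.map_add_eq_mul,
      AddChar.map_neg_eq_conj]
    rfl
  simp_rw [h, AddChar.sum_mulShift _ (ZMod.isPrimitive_stdAddChar M), sub_eq_zero, ZMod.card]
  push_cast
  rfl

lemma modeShift_iterate_apply (M N : ℕ) [NeZero M] (j : ℕ) (n : Fock M N) (m : ZMod M) :
    ((modeShift M N)^[j] n).1 m = n.1 (m - j) := by
  induction j generalizing m with
  | zero => simp
  | succ j ih =>
    rw [Function.iterate_succ_apply']
    change ((modeShift M N)^[j] n).1 (m - 1) = _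
    rw [ih]
    exact congrArg n.1 (by push_cast; ring)

lemma modeShift_iterate_val_add (M N : ℕ) [NeZero M] (a b : ZMod M) (n : Fock M N) :
    (modeShift M N)^[(a + b).val] n = (modeShift M N)^[a.val] ((modeShift M N)^[b.val] n) := by
  ext m
  simp only [modeShift_iterate_apply, ZMod.natCast_zmod_val]
  exact congrArg n.1 (by ring)

/-- The shift by `a` as a permutation of the Fock vectors. -/
def modeShiftEquiv (M N : ℕ) [NeZero M] (a : ZMod M) : Fock M N ≃ Fock M N where
  toFun := (modeShift M N)^[a.val]
  invFun := (modeShift M N)^[(-a).val]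
  left_inv n := by rw [← modeShift_iterate_val_add]; simp
  right_inv n := by rw [← modeShift_iterate_val_add]; simp

lemma tmi_modeShift_iterate (M N : ℕ) [NeZero M] (a : ZMod M) (n : Fock M N) :
    tmi M N ((modeShift M N)^[a.val] n) = tmi M N n + N * a := by
  have hsum : ∑ m, (n.1 m : ZMod M) = N := by exact_mod_cast congrArg (Nat.cast (R := ZMod M)) n.2
  simp only [tmi, modeShift_iterate_apply, ZMod.natCast_zmod_val]
  rw [← Equiv.sum_comp (Equiv.addRight a)]
  simp only [Equiv.coe_addRight, add_sub_cancel_right, add_mul, Finset.sum_add_distrib,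
    ← Finset.mul_sum, hsum]
  ring

lemma trace_mul_HWm (M N : ℕ) [NeZero M] (ρ : Matrix (Fock M N) (Fock M N) ℂ) (k l : ZMod M) :
    Matrix.trace (ρ * HWm M N k l) =
      ∑ n, ρ n ((modeShift M N)^[k.val] n) * hwOmega M ^ (l * tmi M N n).val := by
  simp [Matrix.trace, Matrix.mul_apply, HWm]

lemma rhoHW_apply (M N : ℕ) [NeZero M] (ρ : Matrix (Fock M N) (Fock M N) ℂ) (m m' : ZMod M) :
    rhoHW M N ρ m m' =
      ∑ n, if tmi M N n = N * m then ρ n ((modeShift M N)^[(m' - m).val] n) else 0 := by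
  rw [← (modeShiftEquiv M N m).sum_comp]
  simp only [rhoHW, Matrix.of_apply, modeShiftEquiv, Equiv.coe_fn_mk, tmi_modeShift_iterate,
    add_eq_right, ← modeShift_iterate_val_add, sub_add_cancel]

lemma sum_trace_mul_HWm_mul_conj (M N : ℕ) [NeZero M] (ρ : Matrix (Fock M N) (Fock M N) ℂ)
    (k a : ZMod M) :
    ∑ l, Matrix.trace (ρ * HWm M N k l) * star (hwOmega M ^ (l * a).val) =
      M * ∑ n, if tmi M N n = a then ρ n ((modeShift M N)^[k.val] n) else 0 := by
  simp_rw [trace_mul_HWm, Finset.sum_mul]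
  rw [Finset.sum_comm, Finset.mul_sum]
  refine Finset.sum_congr rfl fun n _ => ?_
  simp_rw [mul_assoc, ← Finset.mul_sum, sum_hwOmega_pow_mul_conj]
  split_ifs <;> ring

/-- The phases cancel between the multiphoton operator and the adjoint single-photon one. -/
lemma trace_smul_conjTranspose_phased {S T : Type*} [Fintype S]
    (ρ A : Matrix S S ℂ) (B : Matrix T T ℂ) (x y : ℝ) (N : ℕ) :
    Matrix.trace (ρ * (Complex.exp (Complex.I * (N : ℂ) * (x : ℂ)) • A)) •
        (Complex.exp (Complex.I * ((N : ℂ) * (x : ℂ) - (y : ℂ))) •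
          (Complex.exp (Complex.I * (y : ℂ)) • B))ᴴ =
      Matrix.trace (ρ * A) • Bᴴ := by
  rw [smul_smul, ← Complex.exp_add, Matrix.conjTranspose_smul, Matrix.mul_smul,
    Matrix.trace_smul, smul_smul, smul_eq_mul, mul_right_comm]
  have h : Complex.exp (Complex.I * N * x) *
      star (Complex.exp (Complex.I * (N * x - y) + Complex.I * y)) = 1 := by
    rw [Complex.star_def, ← Complex.exp_conj, ← Complex.exp_add, Complex.exp_eq_one_iff]
    refine ⟨0, ?_⟩
    simp
    ring
  rw [h, one_mul]

/-- reconstruction of HW-reduced density matrices, general phase convention: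
with `Ω_{k,l} = e^{iNθ(k,l)} • Λ_{k,l}` and `M1_{k,l} = e^{iθ(k,l)} • L_{k,l}`,
`ρ_HW = (1/M) Σ_{k,l} tr(ρ Ω_{k,l}) • (e^{i(Nθ(k,l) − θ(k,Nl))} • M1_{k,Nl})ᴴ`. -/
theorem rhoHW_reconstruction_phased (M N : ℕ) [NeZero M] (hN : 1 ≤ N)
    (hgcd : Nat.gcd N M = 1) (ρ : Matrix (Fock M N) (Fock M N) ℂ)
    (θ : ZMod M → ZMod M → ℝ) :
    rhoHW M N ρ = (1 / (M : ℂ)) • ∑ k : ZMod M, ∑ l : ZMod M,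
      (Matrix.trace (ρ *
          (Complex.exp (Complex.I * (N : ℂ) * (θ k l : ℂ)) • HWm M N k l))) •
        (Complex.exp (Complex.I * ((N : ℂ) * (θ k l : ℂ) - (θ k ((N : ZMod M) * l) : ℂ))) •
          (Complex.exp (Complex.I * (θ k ((N : ZMod M) * l) : ℂ)) •
            HW M k ((N : ZMod M) * l)))ᴴ := by
  simp_rw [trace_smul_conjTranspose_phased]
  ext m m'
  have hM : (M : ℂ) ≠ 0 := Nat.cast_ne_zero.mpr (NeZero.ne M)
  have key (k : ZMod M) : ∑ l, Matrix.trace (ρ * HWm M N k l) * star (HW M k (N * l) m' m) =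
      if k = m' - m then
        M * ∑ n, if tmi M N n = N * m then ρ n ((modeShift M N)^[k.val] n) else 0
      else 0 := by
    have hk : m' = m + k ↔ k = m' - m := by rw [eq_sub_iff_add_eq', eq_comm]
    simp only [HW, Matrix.of_apply, hk]
    split_ifs
    · rw [← sum_trace_mul_HWm_mul_conj]
      refine Finset.sum_congr rfl fun l _ => ?_
      rw [show (N : ZMod M) * l * m = l * (N * m) by ring]
    · simp
  simp only [Matrix.smul_apply, Matrix.sum_apply, Matrix.conjTranspose_apply, smul_eq_mul, key,
    Finset.sum_ite_eq', Finset.mem_univ, if_true]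
  rw [← mul_assoc, one_div_mul_cancel hM, one_mul, rhoHW_apply]

end
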